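/- arXiv:1610.09898 — 8 statements merged into one kernel-verified Lean document; each statement's English description precedes it below -/
import Mathlib

section
/- (Pointwise form of Lemma 2.1, Ševera–Weinstein criterion.) Let Π : V* → V be skew and B : V → V* be skew. If the endomorphism Id − B∘Π : V* → V* is invertible, then the gauge transformation τ_B(Graph Π) = {(Π α, α − B(Π α)) : α ∈ V*} equals Graph Π' for the linear map Π' := Π∘(Id − B∘Π)⁻¹ : V* → V, and Π' is skew. -/
/-- The graph `{(Π α, α) : α ∈ V*}` of a linear map `Π : V* → V`,
as a subspace of `V ⊕ V*`. -/
def graphSub {V : Type*} [AddCommGroup V] [Module ℝ V]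
    (Piv : Module.Dual ℝ V →ₗ[ℝ] V) : Submodule ℝ (V × Module.Dual ℝ V) :=
  LinearMap.range (Piv.prod LinearMap.id)

/-- The gauge transformation of `V ⊕ V*` associated to `B : V → V*`:
`(x, α) ↦ (x, α − B x)`. -/
def gaugeMap {V : Type*} [AddCommGroup V] [Module ℝ V]
    (B : V →ₗ[ℝ] Module.Dual ℝ V) :
    (V × Module.Dual ℝ V) →ₗ[ℝ] (V × Module.Dual ℝ V) :=
  (LinearMap.fst ℝ V (Module.Dual ℝ V)).prod
    (LinearMap.snd ℝ V (Module.Dual ℝ V) - B.comp (LinearMap.fst ℝ V (Module.Dual ℝ V)))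

/-- pointwise Ševera–Weinstein criterion, Lemma 2.1: if `Π : V* → V`
and `B : V → V*` are skew and `Id − B∘Π : V* → V*` is invertible, then
`τ_B(Graph Π) = Graph Π'` where `Π' = Π ∘ (Id − B∘Π)⁻¹`, and `Π'` is skew. -/
theorem gauge_graph_eq_graph_of_invertible
    (V : Type*) [AddCommGroup V] [Module ℝ V] [FiniteDimensional ℝ V]
    (Piv : Module.Dual ℝ V →ₗ[ℝ] V) (B : V →ₗ[ℝ] Module.Dual ℝ V)
    (hPiv : ∀ α β : Module.Dual ℝ V, α (Piv β) = - β (Piv α))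
    (hB : ∀ x y : V, B x y = - B y x)
    (hinv : IsUnit ((1 : Module.End ℝ (Module.Dual ℝ V)) - B ∘ₗ Piv)) :
    (graphSub Piv).map (gaugeMap B) =
      graphSub (Piv ∘ₗ Ring.inverse ((1 : Module.End ℝ (Module.Dual ℝ V)) - B ∘ₗ Piv)) ∧
    (∀ α β : Module.Dual ℝ V,
      α ((Piv ∘ₗ Ring.inverse ((1 : Module.End ℝ (Module.Dual ℝ V)) - B ∘ₗ Piv)) β) =
        - β ((Piv ∘ₗ Ring.inverse ((1 : Module.End ℝ (Module.Dual ℝ V)) - B ∘ₗ Piv)) α)) := by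
  set N := Ring.inverse ((1 : Module.End ℝ (Module.Dual ℝ V)) - B ∘ₗ Piv) with hN
  have h1 : ∀ α, N α - B (Piv (N α)) = α := fun α => by
    have := LinearMap.congr_fun (Ring.mul_inverse_cancel _ hinv) α
    simpa [Module.End.mul_apply] using this
  have h2 : ∀ α, N (α - B (Piv α)) = α := fun α => by
    have := LinearMap.congr_fun (Ring.inverse_mul_cancel _ hinv) α
    simpa only [Module.End.mul_apply, LinearMap.sub_apply, Module.End.one_apply,
      LinearMap.comp_apply] using this
  clear_value N
  constructor
  · ext ⟨x, γ⟩
    simp only [graphSub, gaugeMap, Submodule.mem_map, LinearMap.mem_range]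
    constructor
    · rintro ⟨_, ⟨α, rfl⟩, h⟩
      refine ⟨α - B (Piv α), ?_⟩
      rw [← h]
      apply Prod.ext
      · change Piv (N (α - B (Piv α))) = Piv α
        rw [h2]
      · rfl
    · rintro ⟨α, h⟩
      refine ⟨_, ⟨N α, rfl⟩, ?_⟩
      rw [← h]
      apply Prod.ext
      · rfl
      · exact h1 α
  · intro α β
    change α (Piv (N β)) = - β (Piv (N α))
    have e1 := LinearMap.congr_fun (h1 α) (Piv (N β))
    have e2 := LinearMap.congr_fun (h1 β) (Piv (N α))
    rw [LinearMap.sub_apply] at e1 e2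
    have e3 := hPiv (N α) (N β)
    have e4 := hB (Piv (N α)) (Piv (N β))
    linarith
end

section
/- If D ⊆ V ⊕ V* is a linear Dirac structure which is almost-coupling via H (i.e., H(D) ⊆ H), then dim D_H = dim H and dim D_W = dim W, where D_H := D ∩ (H ⊕ Ann(W)) and D_W := D ∩ (W ⊕ Ann(H)). -/
/-- The canonical symmetric pairing on `V ⊕ V*`:
`⟨(x,α),(y,β)⟩ = α(y) + β(x)`. -/
def diracPairing {V : Type*} [AddCommGroup V] [Module ℝ V]
    (p q : V × Module.Dual ℝ V) : ℝ :=
  p.2 q.1 + q.2 p.1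

/-- A linear Dirac structure on `V`: a subspace of `V ⊕ V*` which is isotropic
for the canonical pairing and has dimension `dim V` (maximally isotropic). -/
def IsLinearDirac {V : Type*} [AddCommGroup V] [Module ℝ V] [FiniteDimensional ℝ V]
    (D : Submodule ℝ (V × Module.Dual ℝ V)) : Prop :=
  (∀ p ∈ D, ∀ q ∈ D, diracPairing p q = 0) ∧
    Module.finrank ℝ D = Module.finrank ℝ V

open Module in
theorem aux_finrank_prod {V U : Type*} [AddCommGroup V] [Module ℝ V] [FiniteDimensional ℝ V]
    [AddCommGroup U] [Module ℝ U] [FiniteDimensional ℝ U]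
    (p : Submodule ℝ V) (q : Submodule ℝ U) :
    finrank ℝ (p.prod q) = finrank ℝ p + finrank ℝ q := by
  rw [← Module.finrank_prod]
  exact LinearEquiv.finrank_eq
    { toFun := fun x => (⟨x.1.1, x.2.1⟩, ⟨x.1.2, x.2.2⟩)
      invFun := fun x => ⟨(x.1.1, x.2.1), x.1.2, x.2.2⟩
      map_add' := fun _ _ => rfl
      map_smul' := fun _ _ => rfl
      left_inv := fun _ => rfl
      right_inv := fun _ => rfl }

/-- The canonical pairing as a bilinear form. -/
def auxB (V : Type*) [AddCommGroup V] [Module ℝ V] :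
    LinearMap.BilinForm ℝ (V × Module.Dual ℝ V) :=
  LinearMap.mk₂ ℝ diracPairing
    (by intro a b c; simp [diracPairing]; ring)
    (by intro a b c; simp [diracPairing]; ring)
    (by intro a b c; simp [diracPairing]; ring)
    (by intro a b c; simp [diracPairing]; ring)

theorem auxB_apply {V : Type*} [AddCommGroup V] [Module ℝ V] (p q : V × Module.Dual ℝ V) :
    auxB V p q = p.2 q.1 + q.2 p.1 := rfl

theorem auxB_refl {V : Type*} [AddCommGroup V] [Module ℝ V] : (auxB V).IsRefl := by
  intro p q h
  rw [auxB_apply] at *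
  linarith

theorem auxB_nondeg {V : Type*} [AddCommGroup V] [Module ℝ V] : (auxB V).Nondegenerate := by
  have key : ∀ p : V × Module.Dual ℝ V, (∀ q, auxB V p q = 0) → p = 0 := by
    intro p h
    ext1
    · refine (Module.forall_dual_apply_eq_zero_iff ℝ _).1 fun f => ?_
      simpa [auxB_apply] using h (0, f)
    · ext v
      simpa [auxB_apply] using h (v, 0)
  exact ⟨key, fun p h => key p fun q => auxB_refl _ _ (h q)⟩

open Module in
theorem aux_key {V : Type*} [AddCommGroup V] [Module ℝ V] [FiniteDimensional ℝ V]
    (D : Submodule ℝ (V × Module.Dual ℝ V)) (hD : IsLinearDirac D)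
    (P Q : Submodule ℝ (V × Module.Dual ℝ V)) (hQ : ∀ x, x ∈ Q ↔ ∀ p ∈ P, auxB V p x = 0) :
    finrank ℝ (D ⊓ Q : Submodule ℝ (V × Module.Dual ℝ V)) + finrank ℝ P
      = finrank ℝ V + finrank ℝ (D ⊓ P : Submodule ℝ (V × Module.Dual ℝ V)) := by
  obtain ⟨h1, h2⟩ := hD
  have hV : finrank ℝ (V × Module.Dual ℝ V) = finrank ℝ V + finrank ℝ V := by
    rw [Module.finrank_prod, Subspace.dual_finrank_eq]
  have hDD : (auxB V).orthogonal D = D := by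
    symm
    apply Submodule.eq_of_le_of_finrank_le
    · intro x hx y hy
      exact h1 y hy x hx
    · rw [LinearMap.BilinForm.finrank_orthogonal auxB_nondeg, hV]; omega
  have hE : D ⊓ Q = (auxB V).orthogonal (D ⊔ P) := by
    apply le_antisymm
    · rintro x ⟨hx, hxq⟩ y hy
      obtain ⟨d, hd, p, hp, rfl⟩ := Submodule.mem_sup.1 hy
      have e1 : auxB V d x = 0 := h1 d hd x hx
      have e2 := (hQ x).1 hxq p hp
      change auxB V (d + p) x = 0
      rw [map_add, LinearMap.add_apply, e1, e2, add_zero]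
    · intro x hx
      refine ⟨?_, (hQ x).2 fun p hp => hx p (Submodule.mem_sup_right hp)⟩
      change x ∈ D
      rw [← hDD]
      exact fun p hp => hx p (Submodule.mem_sup_left hp)
  have h3 := Submodule.finrank_sup_add_finrank_inf_eq D P
  have h4 := Submodule.finrank_le (D ⊔ P)
  rw [hE, LinearMap.BilinForm.finrank_orthogonal auxB_nondeg]
  omega

/-- if a linear Dirac structure `D` is almost-coupling via `H`
(i.e., `H(D) ⊆ H` where `H(D) = {x : ∃ α ∈ Ann(W), (x,α) ∈ D}`), then
`dim D_H = dim H` and `dim D_W = dim W`, where `D_H = D ∩ (H ⊕ Ann(W))` and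
`D_W = D ∩ (W ⊕ Ann(H))`. -/
theorem almostCoupling_dim_components
    (V : Type*) [AddCommGroup V] [Module ℝ V] [FiniteDimensional ℝ V]
    (H W : Submodule ℝ V) (hHW : IsCompl H W)
    (D : Submodule ℝ (V × Module.Dual ℝ V)) (hD : IsLinearDirac D)
    (hAC : ∀ (x : V) (α : Module.Dual ℝ V),
      α ∈ W.dualAnnihilator → (x, α) ∈ D → x ∈ H) :
    Module.finrank ℝ (D ⊓ H.prod W.dualAnnihilator : Submodule ℝ (V × Module.Dual ℝ V)) =
        Module.finrank ℝ H ∧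
    Module.finrank ℝ (D ⊓ W.prod H.dualAnnihilator : Submodule ℝ (V × Module.Dual ℝ V)) =
        Module.finrank ℝ W := by
  have hHWr := Submodule.finrank_add_eq_of_isCompl hHW
  have memW : ∀ (U : Submodule ℝ V) (x : V), (∀ β ∈ U.dualAnnihilator, β x = 0) → x ∈ U := by
    intro U x h
    rw [← Subspace.dualAnnihilator_dualCoannihilator_eq (W := U)]
    exact (Submodule.mem_dualCoannihilator _).2 h
  have k1 := aux_key D hD (W.prod ⊥) ((⊤ : Submodule ℝ V).prod W.dualAnnihilator) (by
    rintro ⟨x, α⟩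
    simp only [Submodule.mem_prod, Submodule.mem_top, true_and, Submodule.mem_dualAnnihilator,
      auxB_apply]
    constructor
    · rintro h ⟨y, β⟩ ⟨hy, hβ⟩
      have hβ' : β = 0 := hβ
      simp [hβ', h y hy]
    · intro h w hw
      simpa using h (w, 0) ⟨hw, rfl⟩)
  have e1 : D ⊓ (⊤ : Submodule ℝ V).prod W.dualAnnihilator = D ⊓ H.prod W.dualAnnihilator := by
    ext ⟨x, α⟩
    constructor
    · rintro ⟨h, -, h2⟩
      exact ⟨h, hAC x α h2 h, h2⟩
    · rintro ⟨h, -, h2⟩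
      exact ⟨h, trivial, h2⟩
  have e2 : D ⊓ W.prod ⊥ = ⊥ := by
    rw [eq_bot_iff]
    rintro ⟨x, α⟩ ⟨h, hx, hα⟩
    have hα' : α = 0 := hα
    subst hα'
    have hxH := hAC x 0 (Submodule.zero_mem _) h
    have : x = 0 := Submodule.disjoint_def.1 hHW.disjoint x hxH hx
    simp [this]
  rw [e1, e2, aux_finrank_prod, finrank_bot, finrank_bot] at k1
  have k2 := aux_key D hD (H.prod W.dualAnnihilator) (W.prod H.dualAnnihilator) (by
    rintro ⟨x, α⟩
    constructor
    · rintro ⟨hx, hα⟩ ⟨y, β⟩ ⟨hy, hβ⟩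
      have a1 := (Submodule.mem_dualAnnihilator _).1 hα y hy
      have a2 := (Submodule.mem_dualAnnihilator _).1 hβ x hx
      simp only [auxB_apply] at *
      linarith
    · intro h
      refine ⟨memW W x fun β hβ => ?_, (Submodule.mem_dualAnnihilator _).2 fun y hy => ?_⟩
      · simpa [auxB_apply] using h (0, β) ⟨H.zero_mem, hβ⟩
      · simpa [auxB_apply] using h (y, 0) ⟨hy, Submodule.zero_mem _⟩)
  rw [aux_finrank_prod] at k2
  have k3 := Subspace.finrank_add_finrank_dualAnnihilator_eq W
  omega
end

section
/- If D ⊆ V ⊕ V* is a linear Dirac structure which is almost-coupling via H, then D decomposes as the internal direct sum D = D_H ⊕ D_W, i.e., D_H ∩ D_W = {0} and D_H + D_W = D, where D_H := D ∩ (H ⊕ Ann(W)) and D_W := D ∩ (W ⊕ Ann(H)). -/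
/-- The pairing as a bilinear form. -/
noncomputable def diracForm (V : Type*) [AddCommGroup V] [Module ℝ V] :
    LinearMap.BilinForm ℝ (V × Module.Dual ℝ V) :=
  LinearMap.mk₂ ℝ diracPairing
    (by intro a b c; simp [diracPairing]; ring)
    (by intro a b c; simp [diracPairing]; ring)
    (by intro a b c; simp [diracPairing]; ring)
    (by intro a b c; simp [diracPairing]; ring)

lemma diracForm_apply {V : Type*} [AddCommGroup V] [Module ℝ V]
    (p q : V × Module.Dual ℝ V) : diracForm V p q = p.2 q.1 + q.2 p.1 := rfl

lemma diracForm_isRefl (V : Type*) [AddCommGroup V] [Module ℝ V] :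
    (diracForm V).IsRefl := by
  intro p q h
  rw [diracForm_apply] at *
  linarith

lemma diracForm_nondegenerate (V : Type*) [AddCommGroup V] [Module ℝ V] :
    (diracForm V).Nondegenerate := by
  refine (LinearMap.IsRefl.nondegenerate_iff_separatingLeft (diracForm_isRefl V)).2 ?_
  intro p hp
  have h2 : p.2 = 0 := by
    ext y
    have := hp (y, 0)
    simpa [diracForm_apply] using this
  have h1 : p.1 = 0 := by
    rw [← Module.forall_dual_apply_eq_zero_iff ℝ]
    intro f
    have := hp (0, f)
    simpa [diracForm_apply] using this
  exact Prod.ext h1 h2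

lemma exists_lift
    (V : Type*) [AddCommGroup V] [Module ℝ V] [FiniteDimensional ℝ V]
    (H W : Submodule ℝ V)
    (D : Submodule ℝ (V × Module.Dual ℝ V)) (hD : IsLinearDirac D)
    (hAC : ∀ (x : V) (α : Module.Dual ℝ V),
      α ∈ W.dualAnnihilator → (x, α) ∈ D → x ∈ H)
    (α : Module.Dual ℝ V) (hα : α ∈ H.dualAnnihilator) :
    ∃ w ∈ W, (w, α) ∈ D := by
  have hle : D ≤ (diracForm V).orthogonal D := fun p hp q hq => hD.1 q hq p hp
  have hperp : D = (diracForm V).orthogonal D := by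
    apply Submodule.eq_of_le_of_finrank_eq hle
    rw [LinearMap.BilinForm.finrank_orthogonal (diracForm_nondegenerate V), hD.2,
      Module.finrank_prod, Subspace.dual_finrank_eq]
    omega
  have hmem : ((0, α) : V × Module.Dual ℝ V) ∈ D ⊔ W.prod ⊥ := by
    rw [← LinearMap.BilinForm.orthogonal_orthogonal (diracForm_nondegenerate V)
      (diracForm_isRefl V) (D ⊔ W.prod ⊥)]
    intro q hq
    have hqD : q ∈ D := by
      rw [hperp]
      exact fun n hn => hq n (Submodule.mem_sup_left hn)
    have hqW : q.2 ∈ W.dualAnnihilator := by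
      rw [Submodule.mem_dualAnnihilator]
      intro w hw
      have := hq (w, 0) (Submodule.mem_sup_right ⟨hw, by simp⟩)
      simpa [diracForm_apply] using this
    have hqH := hAC q.1 q.2 hqW hqD
    have := (Submodule.mem_dualAnnihilator α).1 hα q.1 hqH
    simp [diracForm_apply, this]
  obtain ⟨d, hd, l, hl, h⟩ := Submodule.mem_sup.1 hmem
  have hl2 : l.2 = 0 := hl.2
  have e1 : d.1 + l.1 = 0 := congrArg Prod.fst h
  have e2 : d.2 + l.2 = α := congrArg Prod.snd h
  refine ⟨d.1, ?_, ?_⟩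
  · rw [eq_neg_of_add_eq_zero_left e1]
    exact W.neg_mem hl.1
  · rw [← e2, hl2, add_zero]
    exact hd

/-- if a linear Dirac structure `D` is almost-coupling via `H`, then
`D = D_H ⊕ D_W` (internal direct sum): `D_H ∩ D_W = {0}` and `D_H + D_W = D`,
where `D_H = D ∩ (H ⊕ Ann(W))` and `D_W = D ∩ (W ⊕ Ann(H))`. -/
theorem almostCoupling_direct_sum
    (V : Type*) [AddCommGroup V] [Module ℝ V] [FiniteDimensional ℝ V]
    (H W : Submodule ℝ V) (hHW : IsCompl H W)
    (D : Submodule ℝ (V × Module.Dual ℝ V)) (hD : IsLinearDirac D)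
    (hAC : ∀ (x : V) (α : Module.Dual ℝ V),
      α ∈ W.dualAnnihilator → (x, α) ∈ D → x ∈ H) :
    (D ⊓ H.prod W.dualAnnihilator) ⊓ (D ⊓ W.prod H.dualAnnihilator) = ⊥ ∧
    (D ⊓ H.prod W.dualAnnihilator) ⊔ (D ⊓ W.prod H.dualAnnihilator) = D := by
  constructor
  · rw [eq_bot_iff]
    rintro p ⟨⟨-, h1, h2⟩, -, h3, h4⟩
    have e1 : p.1 = 0 := Submodule.disjoint_def.1 hHW.disjoint _ h1 h3
    have e2 : p.2 = 0 := by
      ext x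
      obtain ⟨a, ha, b, hb, rfl⟩ := Submodule.mem_sup.1
        (hHW.sup_eq_top ▸ Submodule.mem_top : x ∈ H ⊔ W)
      rw [map_add, (Submodule.mem_dualAnnihilator _).1 h4 a ha,
        (Submodule.mem_dualAnnihilator _).1 h2 b hb]
      simp
    exact Prod.ext e1 e2
  · apply le_antisymm (sup_le inf_le_left inf_le_left)
    intro p hp
    let α : Module.Dual ℝ V := p.2 ∘ₗ W.projection H hHW.symm
    have hα : α ∈ H.dualAnnihilator := by
      rw [Submodule.mem_dualAnnihilator]
      intro h hh
      have : W.projection H hHW.symm h = 0 := by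
        rw [Submodule.projection_apply_eq_zero_iff]; exact hh
      simp [α, this]
    have hβ : p.2 - α ∈ W.dualAnnihilator := by
      rw [Submodule.mem_dualAnnihilator]
      intro w hw
      have : W.projection H hHW.symm w = w :=
        Submodule.projection_apply_left hHW.symm ⟨w, hw⟩
      simp [α, this]
    obtain ⟨w, hw, hwD⟩ := exists_lift V H W D hD hAC α hα
    have hsub : (p.1 - w, p.2 - α) ∈ D := D.sub_mem hp hwD
    refine Submodule.mem_sup.2 ⟨(p.1 - w, p.2 - α), ⟨hsub, hAC _ _ hβ hsub, hβ⟩,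
      (w, α), ⟨hwD, hw, hα⟩, ?_⟩
    simp
end

section
/- If D ⊆ V ⊕ V* is a linear Dirac structure which is almost-coupling via H, then there exists a unique skew linear map P : V* → V such that range P ⊆ W, Ann(W) ⊆ ker P, and D_W = {(P η, η) : η ∈ Ann(H)}, where D_W := D ∩ (W ⊕ Ann(H)). (P is the pointwise model of the leaf-tangent Poisson bivector field induced by an almost-coupling Dirac structure.) -/
theorem diracForm_ker (V : Type*) [AddCommGroup V] [Module ℝ V] :
    LinearMap.ker (diracForm V) = ⊥ := by
  rw [eq_bot_iff]
  rintro ⟨x, α⟩ h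
  have h' : ∀ q, diracPairing (x, α) q = 0 := fun q => by
    have := LinearMap.congr_fun (LinearMap.mem_ker.1 h) q
    simpa [diracForm] using this
  have h1 : α = 0 := by
    ext y
    simpa [diracPairing] using h' (y, 0)
  have h2 : x = 0 := by
    rw [← Module.forall_dual_apply_eq_zero_iff ℝ]
    intro β
    simpa [diracPairing] using h' (0, β)
  simp [h1, h2]

theorem dirac_mem_of_orthogonal {V : Type*} [AddCommGroup V] [Module ℝ V]
    [FiniteDimensional ℝ V] {D : Submodule ℝ (V × Module.Dual ℝ V)} (hD : IsLinearDirac D)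
    (p : V × Module.Dual ℝ V) (hp : ∀ q ∈ D, diracPairing q p = 0) : p ∈ D := by
  have h := LinearMap.BilinForm.finrank_add_finrank_orthogonal' (B := diracForm V) D
  rw [diracForm_ker, inf_bot_eq, finrank_bot, add_zero, Module.finrank_prod,
    Subspace.dual_finrank_eq, hD.2] at h
  have hle : D ≤ (diracForm V).orthogonal D := by
    intro a ha
    rw [LinearMap.BilinForm.mem_orthogonal_iff]
    intro b hb
    exact hD.1 b hb a ha
  have heq := Submodule.eq_of_le_of_finrank_le hle (by rw [hD.2]; omega)
  rw [heq, LinearMap.BilinForm.mem_orthogonal_iff]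
  exact hp

theorem dirac_exists {V : Type*} [AddCommGroup V] [Module ℝ V] [FiniteDimensional ℝ V]
    (H W : Submodule ℝ V)
    (D : Submodule ℝ (V × Module.Dual ℝ V)) (hD : IsLinearDirac D)
    (hAC : ∀ (x : V) (α : Module.Dual ℝ V),
      α ∈ W.dualAnnihilator → (x, α) ∈ D → x ∈ H)
    (η : Module.Dual ℝ V) (hη : η ∈ H.dualAnnihilator) : ∃ w ∈ W, (w, η) ∈ D := by
  have key : ((0 : V), η) ∈ D ⊔ W.prod ⊥ := by
    by_contra hn
    obtain ⟨f, hf, hle⟩ := Submodule.exists_le_ker_of_notMem hn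
    let β : Module.Dual ℝ V := f ∘ₗ LinearMap.inl ℝ _ _
    let y : V := (Module.evalEquiv ℝ V).symm (f ∘ₗ LinearMap.inr ℝ _ _)
    have hy : ∀ α : Module.Dual ℝ V, α y = f (0, α) := by
      intro α
      simp [y]
    have hfx : ∀ x α, f (x, α) = β x + α y := by
      intro x α
      rw [hy]
      simp [β, ← map_add]
    have hmem : (y, β) ∈ D := by
      apply dirac_mem_of_orthogonal hD
      rintro ⟨x, α⟩ hq
      have : f (x, α) = 0 := hle (Submodule.mem_sup_left hq)
      rw [hfx] at this
      simp only [diracPairing]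
      linarith
    have hβ : β ∈ W.dualAnnihilator := by
      rw [Submodule.mem_dualAnnihilator]
      intro w hw
      have : f (w, 0) = 0 := hle (Submodule.mem_sup_right (by simp [Submodule.mem_prod, hw]))
      simpa [hfx] using this
    have hyH := hAC y β hβ hmem
    apply hf
    rw [← hy]
    exact (Submodule.mem_dualAnnihilator _).1 hη y hyH
  obtain ⟨⟨x, α⟩, hd, ⟨w, γ⟩, hw, he⟩ := Submodule.mem_sup.1 key
  simp only [Submodule.mem_prod, Submodule.mem_bot] at hw
  obtain ⟨hw, rfl⟩ := hw
  simp only [Prod.mk_add_mk, add_zero, Prod.mk.injEq] at he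
  obtain ⟨h1, rfl⟩ := he
  refine ⟨x, ?_, hd⟩
  rw [eq_neg_of_add_eq_zero_left h1]
  exact W.neg_mem hw

/-- if a linear Dirac structure `D` is almost-coupling via `H`, then
there is a unique skew linear map `P : V* → V` with `range P ⊆ W`,
`Ann(W) ⊆ ker P`, and `D_W = {(P η, η) : η ∈ Ann(H)}`, where
`D_W = D ∩ (W ⊕ Ann(H))`.  (`P` is the pointwise model of the induced
leaf-tangent Poisson bivector field.) -/
theorem almostCoupling_induces_leafTangent_poisson
    (V : Type*) [AddCommGroup V] [Module ℝ V] [FiniteDimensional ℝ V]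
    (H W : Submodule ℝ V) (hHW : IsCompl H W)
    (D : Submodule ℝ (V × Module.Dual ℝ V)) (hD : IsLinearDirac D)
    (hAC : ∀ (x : V) (α : Module.Dual ℝ V),
      α ∈ W.dualAnnihilator → (x, α) ∈ D → x ∈ H) :
    ∃! P : Module.Dual ℝ V →ₗ[ℝ] V,
      (∀ α β : Module.Dual ℝ V, α (P β) = - β (P α)) ∧
      LinearMap.range P ≤ W ∧
      W.dualAnnihilator ≤ LinearMap.ker P ∧
      D ⊓ W.prod H.dualAnnihilator =
        Submodule.map (P.prod LinearMap.id) H.dualAnnihilator := by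
  have huniq : ∀ w ∈ W, ∀ w' ∈ W, ∀ η, (w, η) ∈ D → (w', η) ∈ D → w = w' := by
    intro w hw w' hw' η h h'
    have h0 : (w - w', (0 : Module.Dual ℝ V)) ∈ D := by simpa using D.sub_mem h h'
    have hH := hAC _ _ (Submodule.zero_mem _) h0
    exact sub_eq_zero.1 (Submodule.disjoint_def.1 hHW.disjoint _ hH (W.sub_mem hw hw'))
  let q : V →ₗ[ℝ] V := W.projection H hHW.symm
  have hqW : ∀ w ∈ W, q w = w := fun w hw =>
    Submodule.projection_apply_of_mem_left hHW.symm hw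
  have hqH : ∀ x ∈ H, q x = 0 := fun x hx =>
    (Submodule.projection_apply_eq_zero_iff hHW.symm).2 hx
  have hqm : ∀ x, q x ∈ W := fun x => Submodule.projection_apply_mem hHW.symm x
  have hqs : ∀ x, x - q x ∈ H := fun x => Submodule.sub_projection_mem hHW.symm x
  have hann : ∀ α : Module.Dual ℝ V, α ∘ₗ q ∈ H.dualAnnihilator := by
    intro α
    rw [Submodule.mem_dualAnnihilator]
    intro x hx
    simp [hqH x hx]
  have hannH : ∀ α ∈ H.dualAnnihilator, α ∘ₗ q = α := by
    intro α hα
    ext x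
    have := (Submodule.mem_dualAnnihilator _).1 hα _ (hqs x)
    rw [map_sub] at this
    simp only [LinearMap.comp_apply]
    linarith
  choose f hfW hfD using fun α : Module.Dual ℝ V => dirac_exists H W D hD hAC _ (hann α)
  let P : Module.Dual ℝ V →ₗ[ℝ] V :=
    { toFun := f
      map_add' := fun a b => huniq _ (hfW _) _ (W.add_mem (hfW _) (hfW _)) _ (hfD _)
        (by rw [LinearMap.add_comp]; exact D.add_mem (hfD a) (hfD b))
      map_smul' := fun c a => huniq _ (hfW _) _ (W.smul_mem c (hfW _)) _ (hfD _)
        (by rw [LinearMap.smul_comp]; exact D.smul_mem c (hfD a)) }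
  have hPW : ∀ α, P α ∈ W := hfW
  have hPD : ∀ α, (P α, α ∘ₗ q) ∈ D := hfD
  have hPann : ∀ α ∈ W.dualAnnihilator, P α = 0 := by
    intro α hα
    refine huniq _ (hPW α) _ W.zero_mem _ (hPD α) ?_
    have : α ∘ₗ q = 0 := by
      ext x
      exact (Submodule.mem_dualAnnihilator _).1 hα _ (hqm x)
    rw [this]
    exact D.zero_mem
  refine ⟨P, ⟨?_, ?_, ?_, ?_⟩, ?_⟩
  · intro α β
    have := hD.1 _ (hPD α) _ (hPD β)
    simp only [diracPairing, LinearMap.comp_apply, hqW _ (hPW _)] at this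
    linarith
  · rintro _ ⟨α, rfl⟩
    exact hPW α
  · intro α hα
    exact hPann α hα
  · ext ⟨w, η⟩
    simp only [Submodule.mem_inf, Submodule.mem_prod, Submodule.mem_map, LinearMap.prod_apply,
      Function.prod_apply, LinearMap.id_apply, Prod.mk.injEq]
    constructor
    · rintro ⟨h, hw, hη⟩
      refine ⟨η, hη, ?_, rfl⟩
      have h2 := hPD η
      rw [hannH η hη] at h2
      exact huniq _ (hPW η) _ hw _ h2 h
    · rintro ⟨η', hη, rfl, rfl⟩
      have h2 := hPD η'
      rw [hannH η' hη] at h2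
      exact ⟨h2, hPW _, hη⟩
  · rintro Q ⟨_, hQW, hQann, hQ⟩
    ext1 α
    have hdec : α = α ∘ₗ q + (α - α ∘ₗ q) := by abel
    have hA : α - α ∘ₗ q ∈ W.dualAnnihilator := by
      rw [Submodule.mem_dualAnnihilator]
      intro w hw
      simp [hqW w hw]
    have hQ0 : Q (α - α ∘ₗ q) = 0 := hQann hA
    have hQD : (Q (α ∘ₗ q), α ∘ₗ q) ∈ D ⊓ W.prod H.dualAnnihilator := by
      rw [hQ]
      exact ⟨_, hann α, rfl⟩
    have e : Q α = Q (α ∘ₗ q) := by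
      rw [map_sub, sub_eq_zero] at hQ0
      exact hQ0
    rw [e]
    exact huniq _ (hQW ⟨_, rfl⟩) _ (hPW α) _ hQD.1 (hPD α)
end

section
/- (Pointwise form of the decomposition (D1) of the deformed Dirac structure.) Let P : V* → V be skew with range P ⊆ W and Ann(W) ⊆ ker P, and let Λ : V* → V be skew with range Λ ⊆ H and Ann(H) ⊆ ker Λ. Then Graph(P + Λ) = {(Λ ξ, ξ) : ξ ∈ Ann(W)} ⊕ {(P η, η) : η ∈ Ann(H)} (internal direct sum of subspaces of V ⊕ V*); in particular Graph(P + Λ) is almost-coupling via H, i.e., H(Graph(P+Λ)) ⊆ H. -/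
/-- pointwise form of the decomposition (D1): if `P : V* → V` is
skew with `range P ⊆ W`, `Ann(W) ⊆ ker P`, and `Λ : V* → V` is skew with
`range Λ ⊆ H`, `Ann(H) ⊆ ker Λ`, then
`Graph(P + Λ) = {(Λ ξ, ξ) : ξ ∈ Ann(W)} ⊕ {(P η, η) : η ∈ Ann(H)}`
(an internal direct sum), and `Graph(P + Λ)` is almost-coupling via `H`. -/
theorem graph_sum_decomposition
    (V : Type*) [AddCommGroup V] [Module ℝ V] [FiniteDimensional ℝ V]
    (H W : Submodule ℝ V) (hHW : IsCompl H W)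
    (P : Module.Dual ℝ V →ₗ[ℝ] V)
    (hP : ∀ α β : Module.Dual ℝ V, α (P β) = - β (P α))
    (hPW : LinearMap.range P ≤ W) (hPker : W.dualAnnihilator ≤ LinearMap.ker P)
    (L : Module.Dual ℝ V →ₗ[ℝ] V)
    (hL : ∀ α β : Module.Dual ℝ V, α (L β) = - β (L α))
    (hLH : LinearMap.range L ≤ H) (hLker : H.dualAnnihilator ≤ LinearMap.ker L) :
    graphSub (P + L) =
        Submodule.map (L.prod LinearMap.id) W.dualAnnihilator ⊔
          Submodule.map (P.prod LinearMap.id) H.dualAnnihilator ∧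
    Submodule.map (L.prod LinearMap.id) W.dualAnnihilator ⊓
        Submodule.map (P.prod LinearMap.id) H.dualAnnihilator = ⊥ ∧
    (∀ (x : V) (α : Module.Dual ℝ V),
      α ∈ W.dualAnnihilator → (x, α) ∈ graphSub (P + L) → x ∈ H) := by
  have hsup : W.dualAnnihilator ⊔ H.dualAnnihilator = ⊤ := by
    rw [← Subspace.dualAnnihilator_inf_eq, inf_comm, hHW.inf_eq_bot,
      Submodule.dualAnnihilator_bot]
  have hinf : ∀ ξ : Module.Dual ℝ V, ξ ∈ W.dualAnnihilator → ξ ∈ H.dualAnnihilator →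
      ξ = 0 := by
    intro ξ h1 h2
    have h : ξ ∈ (W ⊔ H).dualAnnihilator := by
      rw [Submodule.dualAnnihilator_sup_eq]
      exact ⟨h1, h2⟩
    rw [sup_comm, hHW.sup_eq_top, Submodule.dualAnnihilator_top] at h
    simpa using h
  have kP : ∀ ξ ∈ W.dualAnnihilator, P ξ = 0 := fun ξ h => hPker h
  have kL : ∀ ξ ∈ H.dualAnnihilator, L ξ = 0 := fun ξ h => hLker h
  refine ⟨le_antisymm ?_ (sup_le ?_ ?_), ?_, ?_⟩
  · rintro _ ⟨α, rfl⟩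
    have hα : α ∈ W.dualAnnihilator ⊔ H.dualAnnihilator := by rw [hsup]; trivial
    obtain ⟨ξ, hξ, η, hη, rfl⟩ := Submodule.mem_sup.1 hα
    refine Submodule.mem_sup.2 ⟨_, ⟨ξ, hξ, rfl⟩, _, ⟨η, hη, rfl⟩, ?_⟩
    simp [kP ξ hξ, kL η hη, add_comm]
  · rintro _ ⟨ξ, hξ, rfl⟩
    exact ⟨ξ, by simp [kP ξ hξ]⟩
  · rintro _ ⟨η, hη, rfl⟩
    exact ⟨η, by simp [kL η hη]⟩
  · rw [eq_bot_iff]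
    rintro _ ⟨⟨ξ, hξ, rfl⟩, ⟨η, hη, h⟩⟩
    have h2 : η = ξ := congrArg Prod.snd h
    subst h2
    have h0 : η = 0 := hinf η hξ hη
    simp [h0]
  · rintro x α hα ⟨β, h⟩
    have h2 : β = α := congrArg Prod.snd h
    have h1 : P β + L β = x := congrArg Prod.fst h
    subst h2
    rw [← h1, kP β hα, zero_add]
    exact hLH ⟨β, rfl⟩
end

section
/- (Pointwise form of Lemma 3.1.) Let D ⊆ V ⊕ V* be a linear Dirac structure which is almost-coupling via H, and let P : V* → V be the induced skew map with range P ⊆ W, Ann(W) ⊆ ker P, and D ∩ (W ⊕ Ann(H)) = {(P η, η) : η ∈ Ann(H)}. Let B : V → V* be skew with (B w)(w') = 0 for all w, w' ∈ W. Then the gauge transformation τ_B(D) := {(x, α − B x) : (x, α) ∈ D} is a linear Dirac structure which is almost-coupling via the subspace H̄ := {h + P(B h) : h ∈ H}, and H̄ is a complement of W in V. -/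
/-- pointwise form of Lemma 3.1: let `D` be a linear Dirac
structure which is almost-coupling via `H`, with induced skew map `P` on
`D_W = D ∩ (W ⊕ Ann(H))`, and let `B : V → V*` be skew and vanishing on
`W × W`.  Then `τ_B(D)` is a linear Dirac structure, almost-coupling via
`H̄ = {h + P(B h) : h ∈ H}`, and `H̄` is a complement of `W` in `V`. -/
theorem gauge_of_almostCoupling
    (V : Type*) [AddCommGroup V] [Module ℝ V] [FiniteDimensional ℝ V]
    (H W : Submodule ℝ V) (hHW : IsCompl H W)
    (D : Submodule ℝ (V × Module.Dual ℝ V)) (hD : IsLinearDirac D)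
    (hAC : ∀ (x : V) (α : Module.Dual ℝ V),
      α ∈ W.dualAnnihilator → (x, α) ∈ D → x ∈ H)
    (P : Module.Dual ℝ V →ₗ[ℝ] V)
    (hP : ∀ α β : Module.Dual ℝ V, α (P β) = - β (P α))
    (hPW : LinearMap.range P ≤ W) (hPker : W.dualAnnihilator ≤ LinearMap.ker P)
    (hDW : D ⊓ W.prod H.dualAnnihilator =
      Submodule.map (P.prod LinearMap.id) H.dualAnnihilator)
    (B : V →ₗ[ℝ] Module.Dual ℝ V)
    (hB : ∀ x y : V, B x y = - B y x)
    (hBW : ∀ w ∈ W, ∀ w' ∈ W, B w w' = 0) :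
    IsLinearDirac (D.map (gaugeMap B)) ∧
    (∀ (x : V) (α : Module.Dual ℝ V),
      α ∈ W.dualAnnihilator → (x, α) ∈ D.map (gaugeMap B) →
        x ∈ Submodule.map (LinearMap.id + P ∘ₗ B) H) ∧
    IsCompl (Submodule.map (LinearMap.id + P ∘ₗ B) H) W := by
  obtain ⟨hiso, hdim⟩ := hD
  have hPmem : ∀ α, P α ∈ W := fun α => hPW ⟨α, rfl⟩
  have hzero : ∀ v, v ∈ H → v ∈ W → v = 0 := fun v h1 h2 =>
    (Submodule.disjoint_def.mp hHW.disjoint) v h1 h2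
  have hdec : ∀ v : V, ∃ h ∈ H, ∃ w ∈ W, h + w = v := fun v =>
    Submodule.mem_sup.mp (by rw [hHW.sup_eq_top]; trivial)
  have hg : ∀ x α, gaugeMap B (x, α) = (x, α - B x) := fun _ _ => rfl
  have hinj : Function.Injective (gaugeMap B) := by
    rintro ⟨x, α⟩ ⟨y, β⟩ h
    simp only [hg, Prod.mk.injEq] at h
    obtain ⟨rfl, h2⟩ := h
    rw [sub_left_inj.mp h2]
  refine ⟨⟨?_, ?_⟩, ?_, ?_⟩
  · rintro _ ⟨⟨x, α⟩, hx, rfl⟩ _ ⟨⟨y, β⟩, hy, rfl⟩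
    have h1 := hiso _ hx _ hy
    have h2 := hB x y
    simp only [diracPairing, hg, LinearMap.sub_apply] at h1 ⊢
    linarith
  · rw [← hdim]
    exact (Submodule.equivMapOfInjective (gaugeMap B) hinj D).finrank_eq.symm
  · rintro x α hα ⟨⟨y, β⟩, hy, heq⟩
    simp only [hg, Prod.mk.injEq] at heq
    obtain ⟨rfl, rfl⟩ := heq
    obtain ⟨h, hh, w, hw, rfl⟩ := hdec y
    have key : w - P (B h) ∈ H := by
      rw [← Subspace.forall_mem_dualAnnihilator_apply_eq_zero_iff]
      intro η hη
      have hmem : (P η, η) ∈ D := by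
        have : (P η, η) ∈ D ⊓ W.prod H.dualAnnihilator := by
          rw [hDW]; exact ⟨η, hη, rfl⟩
        exact this.1
      have h1 := hiso _ hy _ hmem
      have h2 := (Submodule.mem_dualAnnihilator _).mp hα (P η) (hPmem η)
      have h3 := (Submodule.mem_dualAnnihilator _).mp hη h hh
      have h4 := hBW w hw (P η) (hPmem η)
      have h5 := hP (B h) η
      simp only [diracPairing, map_add, LinearMap.sub_apply, LinearMap.add_apply, map_sub]
        at h1 h2 ⊢
      linarith
    have h0 := hzero _ key (W.sub_mem hw (hPmem _))
    refine ⟨h, hh, ?_⟩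
    simp [← sub_eq_zero.mp h0]
  · constructor
    · rw [Submodule.disjoint_def]
      rintro _ ⟨h, hh, rfl⟩ hw
      have h1 : h ∈ W := (Submodule.add_mem_iff_left W (hPmem (B h))).mp hw
      rw [hzero h hh h1, map_zero]
    · rw [codisjoint_iff, eq_top_iff]
      intro v _
      obtain ⟨h, hh, w, hw, rfl⟩ := hdec v
      refine Submodule.mem_sup.mpr ⟨_, ⟨h, hh, rfl⟩, w - P (B h), W.sub_mem hw (hPmem _), ?_⟩
      simp
end

section
/- (Key identity in the proof of Lemma 3.1.) Let D ⊆ V ⊕ V* be a linear Dirac structure which is almost-coupling via H, let P : V* → V be the induced skew map with range P ⊆ W, Ann(W) ⊆ ker P, and D ∩ (W ⊕ Ann(H)) = {(P η, η) : η ∈ Ann(H)}, and let B : V → V* be skew with (B w)(w') = 0 for all w, w' ∈ W. Then H(τ_B(D)) = {x + P(B x) : x ∈ H(D)}, where τ_B(D) := {(x, α − B x) : (x, α) ∈ D}. -/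
/-- key identity in the proof of Lemma 3.1: under the hypotheses
of Lemma 3.1, `H(τ_B(D)) = {x + P(B x) : x ∈ H(D)}`. -/
theorem hdist_gauge_eq_image
    (V : Type*) [AddCommGroup V] [Module ℝ V] [FiniteDimensional ℝ V]
    (H W : Submodule ℝ V) (hHW : IsCompl H W)
    (D : Submodule ℝ (V × Module.Dual ℝ V)) (hD : IsLinearDirac D)
    (hAC : ∀ (x : V) (α : Module.Dual ℝ V),
      α ∈ W.dualAnnihilator → (x, α) ∈ D → x ∈ H)
    (P : Module.Dual ℝ V →ₗ[ℝ] V)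
    (hP : ∀ α β : Module.Dual ℝ V, α (P β) = - β (P α))
    (hPW : LinearMap.range P ≤ W) (hPker : W.dualAnnihilator ≤ LinearMap.ker P)
    (hDW : D ⊓ W.prod H.dualAnnihilator =
      Submodule.map (P.prod LinearMap.id) H.dualAnnihilator)
    (B : V →ₗ[ℝ] Module.Dual ℝ V)
    (hB : ∀ x y : V, B x y = - B y x)
    (hBW : ∀ w ∈ W, ∀ w' ∈ W, B w w' = 0) :
    {x : V | ∃ α ∈ W.dualAnnihilator, (x, α) ∈ D.map (gaugeMap B)} =
      (fun x => x + P (B x)) '' {x : V | ∃ α ∈ W.dualAnnihilator, (x, α) ∈ D} := by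
  have key : ∀ β : Module.Dual ℝ V, ∃ η : Module.Dual ℝ V,
      β - η ∈ W.dualAnnihilator ∧ (P β, η) ∈ D := by
    intro β
    have h1 : β ∈ H.dualAnnihilator ⊔ W.dualAnnihilator := by
      rw [← Subspace.dualAnnihilator_inf_eq, hHW.inf_eq_bot, Submodule.dualAnnihilator_bot]
      trivial
    obtain ⟨η, hη, γ, hγ, rfl⟩ := Submodule.mem_sup.1 h1
    refine ⟨η, by simpa using hγ, ?_⟩
    have h2 : P γ = 0 := hPker hγ
    have h3 : (P η, η) ∈ Submodule.map (P.prod LinearMap.id) H.dualAnnihilator :=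
      ⟨η, hη, rfl⟩
    rw [← hDW] at h3
    simpa [h2] using h3.1
  have hBP : ∀ β : Module.Dual ℝ V, B (P β) ∈ W.dualAnnihilator := by
    intro β
    rw [Submodule.mem_dualAnnihilator]
    exact fun w hw => hBW _ (hPW ⟨β, rfl⟩) w hw
  ext y
  constructor
  · rintro ⟨_, hα, ⟨⟨y', α⟩, hD', he⟩⟩
    obtain ⟨rfl, rfl⟩ := Prod.mk.inj he
    change α - B y' ∈ W.dualAnnihilator at hα
    change y' ∈ _
    obtain ⟨η, h1, h2⟩ := key (B y')
    refine ⟨y' - P (B y'), ⟨α - η, ?_, D.sub_mem hD' h2⟩, ?_⟩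
    · simpa using add_mem hα h1
    · have h3 : P (B (P (B y'))) = 0 := hPker (hBP _)
      simp [h3]
  · rintro ⟨x, ⟨α, hα, hx⟩, rfl⟩
    obtain ⟨η, h1, h2⟩ := key (B x)
    refine ⟨α + η - B (x + P (B x)), ?_, ⟨(x + P (B x), α + η), D.add_mem hx h2, rfl⟩⟩
    have h4 := sub_mem (sub_mem hα h1) (hBP (B x))
    convert h4 using 1
    rw [map_add]
    abel
end

section
/- (Pointwise form of the coupling-form expression in Section 3.) Let Π : V* → V be skew and W ⊆ V a subspace such that Π(Ann(W)) ⊕ W = V (the coupling condition), and set H := Π(Ann(W)). Then the restriction of Π to Ann(W) is a linear isomorphism from Ann(W) onto H. Moreover, letting pr_H : V → H denote the projection along W and Φ := (Π|_{Ann(W)})⁻¹ : H → Ann(W), the bilinear form σ on V defined by σ(u, v) := −(Φ(pr_H u))(pr_H v) is skew-symmetric, vanishes whenever u ∈ W or v ∈ W, and satisfies σ(Π α, Π β) = −α(Π β) for all α, β ∈ Ann(W). -/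
/-- pointwise form of the coupling-form expression, Section 3:
let `Π : V* → V` be skew and `W ⊆ V` with `Π(Ann(W)) ⊕ W = V`, and set
`H = Π(Ann(W))`.  Then `Π` restricts to a bijection from `Ann(W)` onto `H`;
moreover, for the projection `pr_H` onto `H` along `W` and the inverse
`Φ = (Π|_{Ann(W)})⁻¹`, the bilinear form `σ(u,v) = −(Φ(pr_H u))(pr_H v)` is
skew-symmetric, vanishes whenever `u ∈ W` or `v ∈ W`, and satisfies
`σ(Π α, Π β) = −α(Π β)` for all `α, β ∈ Ann(W)`. -/
theorem coupling_form_properties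
    (V : Type*) [AddCommGroup V] [Module ℝ V] [FiniteDimensional ℝ V]
    (Piv : Module.Dual ℝ V →ₗ[ℝ] V)
    (hPiv : ∀ α β : Module.Dual ℝ V, α (Piv β) = - β (Piv α))
    (W : Submodule ℝ V)
    (hcoupling : IsCompl (Submodule.map Piv W.dualAnnihilator) W) :
    Set.BijOn ⇑Piv (W.dualAnnihilator : Set (Module.Dual ℝ V))
      ((Submodule.map Piv W.dualAnnihilator : Submodule ℝ V) : Set V) ∧
    ∀ (pr : V →ₗ[ℝ] V) (Φ : V →ₗ[ℝ] Module.Dual ℝ V) (σ : V → V → ℝ),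
      (∀ h ∈ Submodule.map Piv W.dualAnnihilator, pr h = h) →
      (∀ w ∈ W, pr w = 0) →
      (∀ α ∈ W.dualAnnihilator, Φ (Piv α) = α) →
      (∀ u v : V, σ u v = - (Φ (pr u)) (pr v)) →
      ((∀ u v : V, σ u v = - σ v u) ∧
       (∀ u v : V, u ∈ W ∨ v ∈ W → σ u v = 0) ∧
       (∀ α ∈ W.dualAnnihilator, ∀ β ∈ W.dualAnnihilator,
          σ (Piv α) (Piv β) = - α (Piv β))) := by
  have dec : ∀ v : V, ∃ α ∈ W.dualAnnihilator, ∃ w ∈ W, Piv α + w = v := by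
    intro v
    have hv : v ∈ Submodule.map Piv W.dualAnnihilator ⊔ W := by
      rw [hcoupling.sup_eq_top]
      trivial
    obtain ⟨h, hh, w, hw, e⟩ := Submodule.mem_sup.mp hv
    obtain ⟨α, hα, rfl⟩ := Submodule.mem_map.mp hh
    exact ⟨α, hα, w, hw, e⟩
  refine ⟨⟨fun α hα => Submodule.mem_map_of_mem hα, ?_, ?_⟩, ?_⟩
  · intro α hα β hβ hab
    have hd : α - β ∈ W.dualAnnihilator := Submodule.sub_mem _ hα hβ
    have h0 : Piv (α - β) = 0 := by rw [map_sub, hab, sub_self]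
    have hz : α - β = 0 := by
      ext v
      obtain ⟨γ, _, w, hw, rfl⟩ := dec v
      rw [map_add, hPiv, h0, (Submodule.mem_dualAnnihilator _).mp hd w hw]
      simp
    exact sub_eq_zero.mp hz
  · rintro v ⟨α, hα, rfl⟩
    exact ⟨α, hα, rfl⟩
  · intro pr Φ σ hpr hprW hΦ hσ
    have prdec : ∀ v : V, ∃ α ∈ W.dualAnnihilator, pr v = Piv α := by
      intro v
      obtain ⟨α, hα, w, hw, rfl⟩ := dec v
      refine ⟨α, hα, ?_⟩
      rw [map_add, hpr _ (Submodule.mem_map_of_mem hα), hprW w hw, add_zero]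
    refine ⟨?_, ?_, ?_⟩
    · intro u v
      obtain ⟨α, hα, hu⟩ := prdec u
      obtain ⟨β, hβ, hv⟩ := prdec v
      rw [hσ, hσ, hu, hv, hΦ α hα, hΦ β hβ, hPiv α β]
    · rintro u v (h | h)
      · rw [hσ, hprW u h]
        simp
      · rw [hσ, hprW v h]
        simp
    · intro α hα β hβ
      rw [hσ, hpr _ (Submodule.mem_map_of_mem hα), hpr _ (Submodule.mem_map_of_mem hβ), hΦ α hα]
end
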